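/- (Type casting) Suppose Δ ⊢ M : A is a valid typing judgment, Δ' <: Δ (pointwise subtyping of contexts with the same variables), and A <: A'. Then there exists an indexed term M' with Erase(M) = Erase(M') such that Δ' ⊢ M' : A' is a valid typing judgment. Moreover, if M is a value, then M' is a value. -/

import Mathlib

/- The call-by-value linear lambda calculus of Selinger-Valiron:
   types, subtyping, indexed terms, values, erasure, contexts, typing rules. -/

namespace QLam

/-- Types: A,B ::= α | A ⊸ B | A ⊗ B | ⊤ | !A -/
inductive Ty : Type where
  | tconst : ℕ → Ty
  | arrow : Ty → Ty → Ty
  | tensor : Ty → Ty → Ty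
  | unit : Ty
  | bang : Ty → Ty
deriving DecidableEq

/-- `bangN n A` is `!ⁿA`. -/
def bangN : ℕ → Ty → Ty
  | 0, A => A
  | n + 1, A => Ty.bang (bangN n A)

/-- The subtyping relation `A <: B`. -/
inductive Sub : Ty → Ty → Prop where
  | tconst (n m a : ℕ) : (m = 0 ∨ 1 ≤ n) →
      Sub (bangN n (Ty.tconst a)) (bangN m (Ty.tconst a))
  | unit (n m : ℕ) : (m = 0 ∨ 1 ≤ n) →
      Sub (bangN n Ty.unit) (bangN m Ty.unit)
  | arrow (n m : ℕ) (A A' B B' : Ty) : (m = 0 ∨ 1 ≤ n) → Sub A A' → Sub B B' →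
      Sub (bangN n (Ty.arrow A' B)) (bangN m (Ty.arrow A B'))
  | tensor (n m : ℕ) (A A' B B' : Ty) : (m = 0 ∨ 1 ≤ n) → Sub A A' → Sub B B' →
      Sub (bangN n (Ty.tensor A B)) (bangN m (Ty.tensor A' B'))

/-- Indexed terms.  `letv x A M N` is `let x^A = M in N` (the abbreviation of
    `(λ⁰x^A.N) M`), `letPair n x A y B M N` is `let ⟨x^A,y^B⟩ⁿ = M in N`,
    `letUnit M N` is `let ∗ = M in N`, `star n` is `∗ⁿ`, `lam n x A M` is `λⁿx^A.M`. -/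
inductive Tm : Type where
  | var : ℕ → Ty → Tm
  | cst : ℕ → Ty → Tm
  | star : ℕ → Tm
  | lam : ℕ → ℕ → Ty → Tm → Tm
  | app : Tm → Tm → Tm
  | pair : ℕ → Tm → Tm → Tm
  | letv : ℕ → Ty → Tm → Tm → Tm
  | letPair : ℕ → ℕ → Ty → ℕ → Ty → Tm → Tm → Tm
  | letUnit : Tm → Tm → Tm
deriving DecidableEq

/-- Core values U ::= x^A | c^A | ∗ⁿ | λⁿx^A.M -/
inductive IsCoreValue : Tm → Prop where
  | var (x : ℕ) (A : Ty) : IsCoreValue (.var x A)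
  | cst (c : ℕ) (A : Ty) : IsCoreValue (.cst c A)
  | star (n : ℕ) : IsCoreValue (.star n)
  | lam (n x : ℕ) (A : Ty) (M : Tm) : IsCoreValue (.lam n x A M)

/-- Values V,W ::= U | ⟨V,W⟩ⁿ | let x^A = V in W | let ⟨x^A,y^B⟩ⁿ = V in W | let ∗ = V in W -/
inductive IsValue : Tm → Prop where
  | core {U : Tm} : IsCoreValue U → IsValue U
  | pair {V W : Tm} (n : ℕ) : IsValue V → IsValue W → IsValue (.pair n V W)
  | letv {V W : Tm} (x : ℕ) (A : Ty) : IsValue V → IsValue W → IsValue (.letv x A V W)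
  | letPair {V W : Tm} (n x : ℕ) (A : Ty) (y : ℕ) (B : Ty) :
      IsValue V → IsValue W → IsValue (.letPair n x A y B V W)
  | letUnit {V W : Tm} : IsValue V → IsValue W → IsValue (.letUnit V W)

/-- Untyped (pure) terms. -/
inductive PTm : Type where
  | var : ℕ → PTm
  | cst : ℕ → PTm
  | star : PTm
  | lam : ℕ → PTm → PTm
  | app : PTm → PTm → PTm
  | pair : PTm → PTm → PTm
  | letv : ℕ → PTm → PTm → PTm
  | letPair : ℕ → ℕ → PTm → PTm → PTm
  | letUnit : PTm → PTm → PTm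
deriving DecidableEq

/-- The erasure operation, deleting all type and integer annotations. -/
def erase : Tm → PTm
  | .var x _ => .var x
  | .cst c _ => .cst c
  | .star _ => .star
  | .lam _ x _ M => .lam x (erase M)
  | .app M N => .app (erase M) (erase N)
  | .pair _ M N => .pair (erase M) (erase N)
  | .letv x _ M N => .letv x (erase M) (erase N)
  | .letPair _ x _ y _ M N => .letPair x y (erase M) (erase N)
  | .letUnit M N => .letUnit (erase M) (erase N)

/-- `FreeAt x A M` : the term `M` has a free instance `x^A` of the variable `x`. -/
inductive FreeAt (x : ℕ) : Ty → Tm → Prop where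
  | var (A : Ty) : FreeAt x A (.var x A)
  | lam {A : Ty} {M : Tm} (n y : ℕ) (B : Ty) : y ≠ x → FreeAt x A M →
      FreeAt x A (.lam n y B M)
  | appL {A : Ty} {M : Tm} (N : Tm) : FreeAt x A M → FreeAt x A (.app M N)
  | appR {A : Ty} {N : Tm} (M : Tm) : FreeAt x A N → FreeAt x A (.app M N)
  | pairL {A : Ty} {M : Tm} (n : ℕ) (N : Tm) : FreeAt x A M → FreeAt x A (.pair n M N)
  | pairR {A : Ty} {N : Tm} (n : ℕ) (M : Tm) : FreeAt x A N → FreeAt x A (.pair n M N)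
  | letvL {A : Ty} {M : Tm} (y : ℕ) (B : Ty) (N : Tm) : FreeAt x A M →
      FreeAt x A (.letv y B M N)
  | letvR {A : Ty} {N : Tm} (y : ℕ) (B : Ty) (M : Tm) : y ≠ x → FreeAt x A N →
      FreeAt x A (.letv y B M N)
  | letPairL {A : Ty} {M : Tm} (n y : ℕ) (B : Ty) (z : ℕ) (C : Ty) (N : Tm) :
      FreeAt x A M → FreeAt x A (.letPair n y B z C M N)
  | letPairR {A : Ty} {N : Tm} (n y : ℕ) (B : Ty) (z : ℕ) (C : Ty) (M : Tm) :
      y ≠ x → z ≠ x → FreeAt x A N → FreeAt x A (.letPair n y B z C M N)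
  | letUnitL {A : Ty} {M : Tm} (N : Tm) : FreeAt x A M → FreeAt x A (.letUnit M N)
  | letUnitR {A : Ty} {N : Tm} (M : Tm) : FreeAt x A N → FreeAt x A (.letUnit M N)

/-- `x` occurs free in `M`. -/
def Free (x : ℕ) (M : Tm) : Prop := ∃ A, FreeAt x A M

/-- `x` occurs as a bound variable (binder) somewhere in `M`. -/
inductive BoundIn (x : ℕ) : Tm → Prop where
  | lamB (n : ℕ) (A : Ty) (M : Tm) : BoundIn x (.lam n x A M)
  | lamI {M : Tm} (n y : ℕ) (A : Ty) : BoundIn x M → BoundIn x (.lam n y A M)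
  | appL {M : Tm} (N : Tm) : BoundIn x M → BoundIn x (.app M N)
  | appR {N : Tm} (M : Tm) : BoundIn x N → BoundIn x (.app M N)
  | pairL {M : Tm} (n : ℕ) (N : Tm) : BoundIn x M → BoundIn x (.pair n M N)
  | pairR {N : Tm} (n : ℕ) (M : Tm) : BoundIn x N → BoundIn x (.pair n M N)
  | letvB (A : Ty) (M N : Tm) : BoundIn x (.letv x A M N)
  | letvL {M : Tm} (y : ℕ) (A : Ty) (N : Tm) : BoundIn x M → BoundIn x (.letv y A M N)
  | letvR {N : Tm} (y : ℕ) (A : Ty) (M : Tm) : BoundIn x N → BoundIn x (.letv y A M N)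
  | letPairB1 (n : ℕ) (A : Ty) (z : ℕ) (B : Ty) (M N : Tm) :
      BoundIn x (.letPair n x A z B M N)
  | letPairB2 (n y : ℕ) (A : Ty) (B : Ty) (M N : Tm) :
      BoundIn x (.letPair n y A x B M N)
  | letPairL {M : Tm} (n y : ℕ) (A : Ty) (z : ℕ) (B : Ty) (N : Tm) :
      BoundIn x M → BoundIn x (.letPair n y A z B M N)
  | letPairR {N : Tm} (n y : ℕ) (A : Ty) (z : ℕ) (B : Ty) (M : Tm) :
      BoundIn x N → BoundIn x (.letPair n y A z B M N)
  | letUnitL {M : Tm} (N : Tm) : BoundIn x M → BoundIn x (.letUnit M N)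
  | letUnitR {N : Tm} (M : Tm) : BoundIn x N → BoundIn x (.letUnit M N)

/-- Capture-avoiding (up to the usual variable conventions) substitution on untyped terms. -/
def psubst (x : ℕ) (V : PTm) : PTm → PTm
  | .var y => if y = x then V else .var y
  | .cst c => .cst c
  | .star => .star
  | .lam y M => if y = x then .lam y M else .lam y (psubst x V M)
  | .app M N => .app (psubst x V M) (psubst x V N)
  | .pair M N => .pair (psubst x V M) (psubst x V N)
  | .letv y M N => .letv y (psubst x V M) (if y = x then N else psubst x V N)
  | .letPair y z M N =>
      .letPair y z (psubst x V M) (if y = x ∨ z = x then N else psubst x V N)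
  | .letUnit M N => .letUnit (psubst x V M) (psubst x V N)

/-- Typing contexts: finite partial assignments of types to variables. -/
abbrev Ctx : Type := ℕ → Option Ty

/-- The empty context. -/
def emptyC : Ctx := fun _ => none

/-- Context extension `Δ, x:A`. -/
def extC (Δ : Ctx) (x : ℕ) (A : Ty) : Ctx := fun y => if y = x then some A else Δ y

/-- Disjointness of contexts. -/
def DisjC (Γ₁ Γ₂ : Ctx) : Prop := ∀ x, Γ₁ x = none ∨ Γ₂ x = none

/-- Union of contexts (left-biased; used on disjoint contexts). -/
def unionC (Γ₁ Γ₂ : Ctx) : Ctx := fun x => (Γ₁ x).orElse (fun _ => Γ₂ x)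

/-- `Δ` is of the form `!Δ'`: every type occurring in `Δ` is of the form `!B`. -/
def IsBangC (Δ : Ctx) : Prop := ∀ x A, Δ x = some A → ∃ B, A = Ty.bang B

/-- `!Δ`, obtained from `Δ` by prefixing every type with `!`. -/
def bangifyC (Δ : Ctx) : Ctx := fun x => (Δ x).map Ty.bang

/-- The typing rules of Table 1.  The parameter `cty` assigns to each constant `c`
    the type `A_c`; the type assigned to `c` is `!A_c`. -/
inductive Typing (cty : ℕ → Ty) : Ctx → Tm → Ty → Prop where
  | var {Δ : Ctx} {x : ℕ} {A B : Ty} :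
      IsBangC Δ → Δ x = none → Sub A B →
      Typing cty (extC Δ x A) (.var x B) B
  | cst {Δ : Ctx} {c : ℕ} {B : Ty} :
      IsBangC Δ → Sub (.bang (cty c)) B →
      Typing cty Δ (.cst c B) B
  | star {Δ : Ctx} {n : ℕ} :
      IsBangC Δ →
      Typing cty Δ (.star n) (bangN n .unit)
  | lam0 {Δ : Ctx} {x : ℕ} {A : Ty} {M : Tm} {B : Ty} :
      Δ x = none → Typing cty (extC Δ x A) M B →
      Typing cty Δ (.lam 0 x A M) (.arrow A B)
  | lamS {Δ : Ctx} {n x : ℕ} {A : Ty} {M : Tm} {B : Ty} :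
      IsBangC Δ → Δ x = none → Typing cty (extC Δ x A) M B →
      Typing cty Δ (.lam (n + 1) x A M) (bangN (n + 1) (.arrow A B))
  | app {Δ Γ₁ Γ₂ : Ctx} {M N : Tm} {A B : Ty} :
      IsBangC Δ → DisjC Γ₁ Γ₂ → DisjC Γ₁ Δ → DisjC Γ₂ Δ →
      Typing cty (unionC Γ₁ Δ) M (.arrow A B) →
      Typing cty (unionC Γ₂ Δ) N A →
      Typing cty (unionC Γ₁ (unionC Γ₂ Δ)) (.app M N) B
  | pair {Δ Γ₁ Γ₂ : Ctx} {n : ℕ} {M₁ M₂ : Tm} {A₁ A₂ : Ty} :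
      IsBangC Δ → DisjC Γ₁ Γ₂ → DisjC Γ₁ Δ → DisjC Γ₂ Δ →
      Typing cty (unionC Γ₁ Δ) M₁ (bangN n A₁) →
      Typing cty (unionC Γ₂ Δ) M₂ (bangN n A₂) →
      Typing cty (unionC Γ₁ (unionC Γ₂ Δ)) (.pair n M₁ M₂) (bangN n (.tensor A₁ A₂))
  | letv {Δ Γ₁ Γ₂ : Ctx} {x : ℕ} {A : Ty} {M N : Tm} {B : Ty} :
      IsBangC Δ → DisjC Γ₁ Γ₂ → DisjC Γ₁ Δ → DisjC Γ₂ Δ →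
      (unionC Γ₁ (unionC Γ₂ Δ)) x = none →
      Typing cty (unionC Γ₁ Δ) M A →
      Typing cty (extC (unionC Γ₂ Δ) x A) N B →
      Typing cty (unionC Γ₁ (unionC Γ₂ Δ)) (.letv x A M N) B
  | letUnit {Δ Γ₁ Γ₂ : Ctx} {M N : Tm} {A : Ty} :
      IsBangC Δ → DisjC Γ₁ Γ₂ → DisjC Γ₁ Δ → DisjC Γ₂ Δ →
      Typing cty (unionC Γ₁ Δ) M .unit →
      Typing cty (unionC Γ₂ Δ) N A →
      Typing cty (unionC Γ₁ (unionC Γ₂ Δ)) (.letUnit M N) A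
  | letPair {Δ Γ₁ Γ₂ : Ctx} {n x₁ : ℕ} {A₁ : Ty} {x₂ : ℕ} {A₂ : Ty} {M N : Tm} {A : Ty} :
      IsBangC Δ → DisjC Γ₁ Γ₂ → DisjC Γ₁ Δ → DisjC Γ₂ Δ →
      x₁ ≠ x₂ →
      (unionC Γ₁ (unionC Γ₂ Δ)) x₁ = none →
      (unionC Γ₁ (unionC Γ₂ Δ)) x₂ = none →
      Typing cty (unionC Γ₁ Δ) M (bangN n (.tensor A₁ A₂)) →
      Typing cty (extC (extC (unionC Γ₂ Δ) x₁ (bangN n A₁)) x₂ (bangN n A₂)) N A →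
      Typing cty (unionC Γ₁ (unionC Γ₂ Δ)) (.letPair n x₁ A₁ x₂ A₂ M N) A

/-- Pointwise subtyping of contexts with the same variables: `Δ' <: Δ`. -/
def SubCtx (Δ' Δ : Ctx) : Prop :=
  (∀ x, Δ x = none → Δ' x = none) ∧
  (∀ x A, Δ x = some A → ∃ A', Δ' x = some A' ∧ Sub A' A)

end QLam

namespace QLam

theorem bangN_inj {A B : Ty} (hA : ∀ C, A ≠ .bang C) (hB : ∀ C, B ≠ .bang C) :
    ∀ {n m : ℕ}, bangN n A = bangN m B → n = m ∧ A = B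
  | 0, 0, h => ⟨rfl, h⟩
  | 0, _ + 1, h => (hA _ h).elim
  | _ + 1, 0, h => (hB _ h.symm).elim
  | n + 1, m + 1, h => by
    obtain ⟨rfl, rfl⟩ := bangN_inj hA hB (Ty.bang.inj h)
    exact ⟨rfl, rfl⟩

theorem bangN_bangN (n k : ℕ) (A : Ty) : bangN n (bangN k A) = bangN (n + k) A := by
  induction n with
  | zero => simp [bangN]
  | succ n ih => rw [Nat.succ_add]; exact congrArg Ty.bang ih

theorem Sub.bangN {A B : Ty} {n m : ℕ} (hnm : m = 0 ∨ 1 ≤ n) (h : Sub A B) :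
    Sub (bangN n A) (bangN m B) := by
  cases h with
  | tconst k l a hkl =>
    rw [bangN_bangN, bangN_bangN]
    exact .tconst _ _ _ (by omega)
  | unit k l hkl =>
    rw [bangN_bangN, bangN_bangN]
    exact .unit _ _ (by omega)
  | arrow k l _ _ _ _ hkl h₁ h₂ =>
    rw [bangN_bangN, bangN_bangN]
    exact .arrow _ _ _ _ _ _ (by omega) h₁ h₂
  | tensor k l _ _ _ _ hkl h₁ h₂ =>
    rw [bangN_bangN, bangN_bangN]
    exact .tensor _ _ _ _ _ _ (by omega) h₁ h₂

theorem Sub.refl (A : Ty) : Sub A A := by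
  induction A with
  | tconst a => exact .tconst 0 0 a (.inl rfl)
  | unit => exact .unit 0 0 (.inl rfl)
  | arrow A B ihA ihB => exact .arrow 0 0 _ _ _ _ (.inl rfl) ihA ihB
  | tensor A B ihA ihB => exact .tensor 0 0 _ _ _ _ (.inl rfl) ihA ihB
  | bang A ih => exact ih.bangN (n := 1) (m := 1) (.inr le_rfl)

theorem Sub.of_tconst_left {n a : ℕ} {T : Ty} (h : Sub (QLam.bangN n (.tconst a)) T) :
    ∃ m, T = QLam.bangN m (.tconst a) ∧ (m = 0 ∨ 1 ≤ n) := by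
  generalize hS : QLam.bangN n (.tconst a) = S at h
  cases h <;> obtain ⟨rfl, h'⟩ := bangN_inj (by simp) (by simp) hS <;> cases h'
  exact ⟨_, rfl, ‹_›⟩

theorem Sub.of_tconst_right {m a : ℕ} {T : Ty} (h : Sub T (QLam.bangN m (.tconst a))) :
    ∃ n, T = QLam.bangN n (.tconst a) ∧ (m = 0 ∨ 1 ≤ n) := by
  generalize hS : QLam.bangN m (.tconst a) = S at h
  cases h <;> obtain ⟨rfl, h'⟩ := bangN_inj (by simp) (by simp) hS <;> cases h'
  exact ⟨_, rfl, ‹_›⟩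

theorem Sub.of_unit_left {n : ℕ} {T : Ty} (h : Sub (QLam.bangN n .unit) T) :
    ∃ m, T = QLam.bangN m .unit ∧ (m = 0 ∨ 1 ≤ n) := by
  generalize hS : QLam.bangN n .unit = S at h
  cases h <;> obtain ⟨rfl, h'⟩ := bangN_inj (by simp) (by simp) hS <;> cases h'
  exact ⟨_, rfl, ‹_›⟩

theorem Sub.of_unit_right {m : ℕ} {T : Ty} (h : Sub T (QLam.bangN m .unit)) :
    ∃ n, T = QLam.bangN n .unit ∧ (m = 0 ∨ 1 ≤ n) := by
  generalize hS : QLam.bangN m .unit = S at h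
  cases h <;> obtain ⟨rfl, h'⟩ := bangN_inj (by simp) (by simp) hS <;> cases h'
  exact ⟨_, rfl, ‹_›⟩

theorem Sub.of_arrow_left {n : ℕ} {A B T : Ty} (h : Sub (QLam.bangN n (.arrow A B)) T) :
    ∃ m A' B', T = QLam.bangN m (.arrow A' B') ∧ (m = 0 ∨ 1 ≤ n) ∧ Sub A' A ∧ Sub B B' := by
  generalize hS : QLam.bangN n (.arrow A B) = S at h
  cases h <;> obtain ⟨rfl, h'⟩ := bangN_inj (by simp) (by simp) hS <;> cases h'
  exact ⟨_, _, _, rfl, ‹_›, ‹_›, ‹_›⟩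

theorem Sub.of_arrow_right {m : ℕ} {A B T : Ty} (h : Sub T (QLam.bangN m (.arrow A B))) :
    ∃ n A' B', T = QLam.bangN n (.arrow A' B') ∧ (m = 0 ∨ 1 ≤ n) ∧ Sub A A' ∧ Sub B' B := by
  generalize hS : QLam.bangN m (.arrow A B) = S at h
  cases h <;> obtain ⟨rfl, h'⟩ := bangN_inj (by simp) (by simp) hS <;> cases h'
  exact ⟨_, _, _, rfl, ‹_›, ‹_›, ‹_›⟩

theorem Sub.of_tensor_left {n : ℕ} {A B T : Ty} (h : Sub (QLam.bangN n (.tensor A B)) T) :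
    ∃ m A' B', T = QLam.bangN m (.tensor A' B') ∧ (m = 0 ∨ 1 ≤ n) ∧ Sub A A' ∧ Sub B B' := by
  generalize hS : QLam.bangN n (.tensor A B) = S at h
  cases h <;> obtain ⟨rfl, h'⟩ := bangN_inj (by simp) (by simp) hS <;> cases h'
  exact ⟨_, _, _, rfl, ‹_›, ‹_›, ‹_›⟩

theorem Sub.of_tensor_right {m : ℕ} {A B T : Ty} (h : Sub T (QLam.bangN m (.tensor A B))) :
    ∃ n A' B', T = QLam.bangN n (.tensor A' B') ∧ (m = 0 ∨ 1 ≤ n) ∧ Sub A' A ∧ Sub B' B := by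
  generalize hS : QLam.bangN m (.tensor A B) = S at h
  cases h <;> obtain ⟨rfl, h'⟩ := bangN_inj (by simp) (by simp) hS <;> cases h'
  exact ⟨_, _, _, rfl, ‹_›, ‹_›, ‹_›⟩

theorem Sub.trans_left_right {A B : Ty} (h : Sub A B) :
    (∀ C, Sub B C → Sub A C) ∧ (∀ C, Sub C A → Sub C B) := by
  induction h with
  | tconst n m a hnm =>
    constructor
    · intro C hC
      obtain ⟨k, rfl, hk⟩ := hC.of_tconst_left
      exact .tconst _ _ _ (by omega)
    · intro C hC
      obtain ⟨k, rfl, hk⟩ := hC.of_tconst_right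
      exact .tconst _ _ _ (by omega)
  | unit n m hnm =>
    constructor
    · intro C hC
      obtain ⟨k, rfl, hk⟩ := hC.of_unit_left
      exact .unit _ _ (by omega)
    · intro C hC
      obtain ⟨k, rfl, hk⟩ := hC.of_unit_right
      exact .unit _ _ (by omega)
  | arrow n m A A' B B' hnm _ _ ihA ihB =>
    constructor
    · intro C hC
      obtain ⟨k, D, E, rfl, hk, hD, hE⟩ := hC.of_arrow_left
      exact .arrow _ _ _ _ _ _ (by omega) (ihA.2 _ hD) (ihB.1 _ hE)
    · intro C hC
      obtain ⟨k, D, E, rfl, hk, hD, hE⟩ := hC.of_arrow_right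
      exact .arrow _ _ _ _ _ _ (by omega) (ihA.1 _ hD) (ihB.2 _ hE)
  | tensor n m A A' B B' hnm _ _ ihA ihB =>
    constructor
    · intro C hC
      obtain ⟨k, D, E, rfl, hk, hD, hE⟩ := hC.of_tensor_left
      exact .tensor _ _ _ _ _ _ (by omega) (ihA.1 _ hD) (ihB.1 _ hE)
    · intro C hC
      obtain ⟨k, D, E, rfl, hk, hD, hE⟩ := hC.of_tensor_right
      exact .tensor _ _ _ _ _ _ (by omega) (ihA.2 _ hD) (ihB.2 _ hE)

theorem Sub.trans {A B C : Ty} (h₁ : Sub A B) (h₂ : Sub B C) : Sub A C :=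
  h₁.trans_left_right.1 C h₂

theorem Sub.eq_bang {A B : Ty} (h : Sub A (.bang B)) : ∃ C, A = .bang C := by
  generalize hS : Ty.bang B = S at h
  cases h with
  | tconst n m _ hnm | unit n m hnm | arrow n m _ _ _ _ hnm _ _ | tensor n m _ _ _ _ hnm _ _ =>
    rcases m with _ | m
    · cases hS
    · obtain ⟨n, rfl⟩ := Nat.exists_eq_add_of_le' (hnm.resolve_left (by simp))
      exact ⟨_, rfl⟩

theorem SubCtx.isBangC {Δ' Δ : Ctx} (h : SubCtx Δ' Δ) (hΔ : IsBangC Δ) : IsBangC Δ' := by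
  intro x A hA
  cases hx : Δ x with
  | none => simp [h.1 x hx] at hA
  | some B =>
    obtain ⟨A', hA', hs⟩ := h.2 x B hx
    obtain ⟨C, rfl⟩ := hΔ x B hx
    obtain rfl : A = A' := by simpa [hA] using hA'
    exact hs.eq_bang

theorem SubCtx.extC {Δ' Δ : Ctx} {A' A : Ty} (h : SubCtx Δ' Δ) (x : ℕ) (hA : Sub A' A) :
    SubCtx (extC Δ' x A') (extC Δ x A) := by
  constructor
  · intro y hy
    by_cases hyx : y = x <;> simp_all [QLam.extC, h.1 y]
  · intro y B hy
    by_cases hyx : y = x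
    · simp_all [QLam.extC]
    · simp only [QLam.extC, hyx, if_false] at hy ⊢
      exact h.2 y B hy

/-- The restriction of the context `Δ` to the variables declared in `Γ`. -/
def restrictC (Δ Γ : Ctx) : Ctx := fun x => (Γ x).bind fun _ => Δ x

theorem restrictC_eq_none {Δ Γ : Ctx} {x : ℕ} (h : Γ x = none) : restrictC Δ Γ x = none := by
  simp [restrictC, h]

theorem DisjC.restrictC {Γ₁ Γ₂ : Ctx} (h : DisjC Γ₁ Γ₂) (Δ : Ctx) :
    DisjC (restrictC Δ Γ₁) (restrictC Δ Γ₂) :=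
  fun x => (h x).imp restrictC_eq_none restrictC_eq_none

theorem subCtx_restrictC {Δ Γ : Ctx} (h : ∀ x A, Γ x = some A → ∃ A', Δ x = some A' ∧ Sub A' A) :
    SubCtx (restrictC Δ Γ) Γ := by
  refine ⟨fun x hx => restrictC_eq_none hx, fun x A hx => ?_⟩
  simpa [restrictC, hx] using h x A hx

theorem SubCtx.unionC {Γ₁' Γ₁ Γ₂' Γ₂ : Ctx} (h₁ : SubCtx Γ₁' Γ₁) (h₂ : SubCtx Γ₂' Γ₂) :
    SubCtx (unionC Γ₁' Γ₂') (unionC Γ₁ Γ₂) := by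
  refine ⟨fun x hx => ?_, fun x A hx => ?_⟩ <;> cases hΓ : Γ₁ x with
  | none => simp_all [QLam.unionC, h₁.1 x hΓ, h₂.1 x, h₂.2 x]
  | some B =>
    obtain ⟨B', hB', hs⟩ := h₁.2 x B hΓ
    simp_all [QLam.unionC]

theorem SubCtx.exists_unionC {Θ Γ₁ Γ₂ Δ : Ctx} (h : SubCtx Θ (QLam.unionC Γ₁ (QLam.unionC Γ₂ Δ)))
    (h₁₂ : DisjC Γ₁ Γ₂) (h₁ : DisjC Γ₁ Δ) (h₂ : DisjC Γ₂ Δ) :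
    ∃ Γ₁' Γ₂' Δ' : Ctx, Θ = QLam.unionC Γ₁' (QLam.unionC Γ₂' Δ') ∧
      DisjC Γ₁' Γ₂' ∧ DisjC Γ₁' Δ' ∧ DisjC Γ₂' Δ' ∧
      SubCtx Γ₁' Γ₁ ∧ SubCtx Γ₂' Γ₂ ∧ SubCtx Δ' Δ := by
  refine ⟨restrictC Θ Γ₁, restrictC Θ Γ₂, restrictC Θ Δ, ?_, h₁₂.restrictC Θ, h₁.restrictC Θ,
    h₂.restrictC Θ, subCtx_restrictC fun x A hx => h.2 x A ?_,
    subCtx_restrictC fun x A hx => h.2 x A ?_, subCtx_restrictC fun x A hx => h.2 x A ?_⟩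
  · funext x
    have := h.1 x
    cases hx₁ : Γ₁ x <;> cases hx₂ : Γ₂ x <;> cases hx : Δ x <;> cases hΘ : Θ x <;>
      simp_all [QLam.unionC, restrictC]
  · simp [QLam.unionC, hx]
  · simp [QLam.unionC, hx, (h₁₂ x).resolve_right (by simp [hx])]
  · simp [QLam.unionC, hx, (h₁ x).resolve_right (by simp [hx]),
      (h₂ x).resolve_right (by simp [hx])]

theorem SubCtx.exists_extC {Θ Δ : Ctx} {x : ℕ} {A : Ty} (h : SubCtx Θ (QLam.extC Δ x A))
    (hx : Δ x = none) :
    ∃ Δ' A', Θ = QLam.extC Δ' x A' ∧ Δ' x = none ∧ SubCtx Δ' Δ ∧ Sub A' A := by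
  obtain ⟨A', hA', hs⟩ := h.2 x A (by simp [QLam.extC])
  refine ⟨restrictC Θ Δ, A', ?_, restrictC_eq_none hx,
    subCtx_restrictC fun y B hy => h.2 y B ?_, hs⟩
  · funext y
    have := h.1 y
    by_cases hyx : y = x
    · simp_all [QLam.extC]
    · cases hy : Δ y <;> simp_all [QLam.extC, restrictC]
  · have hyx : y ≠ x := by rintro rfl; simp [hx] at hy
    simp [QLam.extC, hyx, hy]

/-- **Type casting.** Suppose `Δ ⊢ M : A` is a valid typing judgment,
`Δ' <: Δ` (pointwise subtyping of contexts with the same variables) and `A <: A'`.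
Then there is an indexed term `M'` with the same erasure as `M` such that
`Δ' ⊢ M' : A'` is valid; moreover if `M` is a value then `M'` is a value. -/
theorem type_casting (cty : ℕ → Ty) (Δ Δ' : Ctx) (M : Tm) (A A' : Ty)
    (h : Typing cty Δ M A) (hctx : SubCtx Δ' Δ) (hsub : Sub A A') :
    ∃ M' : Tm, erase M' = erase M ∧ Typing cty Δ' M' A' ∧ (IsValue M → IsValue M') := by
  induction h generalizing Δ' A' with
  | @var Δ x A B hΔ hx hAB =>
    obtain ⟨Δ₀, A₀, rfl, hx₀, hs, hA⟩ := hctx.exists_extC hx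
    exact ⟨.var x A', rfl, .var (hs.isBangC hΔ) hx₀ ((hA.trans hAB).trans hsub),
      fun _ => .core (.var _ _)⟩
  | @cst Δ c B hΔ hB =>
    exact ⟨.cst c A', rfl, .cst (hctx.isBangC hΔ) (hB.trans hsub), fun _ => .core (.cst _ _)⟩
  | @star Δ n hΔ =>
    obtain ⟨m, rfl, -⟩ := hsub.of_unit_left
    exact ⟨.star m, rfl, .star (hctx.isBangC hΔ), fun _ => .core (.star _)⟩
  | @lam0 Δ x A M B hx _ ih =>
    obtain ⟨m, C, D, rfl, hm, hC, hD⟩ := Sub.of_arrow_left (n := 0) hsub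
    obtain rfl : m = 0 := by omega
    obtain ⟨M', hM, hT, -⟩ := ih _ _ (hctx.extC x hC) hD
    exact ⟨.lam 0 x C M', by simp [erase, hM], .lam0 (hctx.1 x hx) hT,
      fun _ => .core (.lam _ _ _ _)⟩
  | @lamS Δ n x A M B hΔ hx _ ih =>
    obtain ⟨m, C, D, rfl, -, hC, hD⟩ := hsub.of_arrow_left
    obtain ⟨M', hM, hT, -⟩ := ih _ _ (hctx.extC x hC) hD
    refine ⟨.lam m x C M', by simp [erase, hM], ?_, fun _ => .core (.lam _ _ _ _)⟩
    cases m with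
    | zero => exact .lam0 (hctx.1 x hx) hT
    | succ m => exact .lamS (hctx.isBangC hΔ) (hctx.1 x hx) hT
  | @app Δ Γ₁ Γ₂ M N A B hΔ h₁₂ h₁ h₂ _ _ ihM ihN =>
    obtain ⟨Γ₁', Γ₂', Δ₀, rfl, k₁₂, k₁, k₂, s₁, s₂, s⟩ := hctx.exists_unionC h₁₂ h₁ h₂
    obtain ⟨M', hM, hMT, -⟩ :=
      ihM _ _ (s₁.unionC s) (.arrow 0 0 _ _ _ _ (.inl rfl) (.refl A) hsub)
    obtain ⟨N', hN, hNT, -⟩ := ihN _ _ (s₂.unionC s) (.refl A)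
    refine ⟨.app M' N', by simp [erase, hM, hN],
      .app (s.isBangC hΔ) k₁₂ k₁ k₂ hMT hNT, fun hV => ?_⟩
    cases hV with | core hV => cases hV
  | @pair Δ Γ₁ Γ₂ n M N A B hΔ h₁₂ h₁ h₂ _ _ ihM ihN =>
    obtain ⟨Γ₁', Γ₂', Δ₀, rfl, k₁₂, k₁, k₂, s₁, s₂, s⟩ := hctx.exists_unionC h₁₂ h₁ h₂
    obtain ⟨m, C, D, rfl, hm, hC, hD⟩ := hsub.of_tensor_left
    obtain ⟨M', hM, hMT, hMV⟩ := ihM _ _ (s₁.unionC s) (hC.bangN hm)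
    obtain ⟨N', hN, hNT, hNV⟩ := ihN _ _ (s₂.unionC s) (hD.bangN hm)
    refine ⟨.pair m M' N', by simp [erase, hM, hN],
      .pair (s.isBangC hΔ) k₁₂ k₁ k₂ hMT hNT, fun hV => ?_⟩
    cases hV with
    | core hV => cases hV
    | pair _ hV hW => exact .pair _ (hMV hV) (hNV hW)
  | @letv Δ Γ₁ Γ₂ x A M N B hΔ h₁₂ h₁ h₂ hx _ _ ihM ihN =>
    have hx' := hctx.1 x hx
    obtain ⟨Γ₁', Γ₂', Δ₀, rfl, k₁₂, k₁, k₂, s₁, s₂, s⟩ := hctx.exists_unionC h₁₂ h₁ h₂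
    obtain ⟨M', hM, hMT, hMV⟩ := ihM _ _ (s₁.unionC s) (.refl A)
    obtain ⟨N', hN, hNT, hNV⟩ := ihN _ _ ((s₂.unionC s).extC x (.refl A)) hsub
    refine ⟨.letv x A M' N', by simp [erase, hM, hN],
      .letv (s.isBangC hΔ) k₁₂ k₁ k₂ hx' hMT hNT, fun hV => ?_⟩
    cases hV with
    | core hV => cases hV
    | letv _ _ hV hW => exact .letv _ _ (hMV hV) (hNV hW)
  | @letUnit Δ Γ₁ Γ₂ M N A hΔ h₁₂ h₁ h₂ _ _ ihM ihN =>
    obtain ⟨Γ₁', Γ₂', Δ₀, rfl, k₁₂, k₁, k₂, s₁, s₂, s⟩ := hctx.exists_unionC h₁₂ h₁ h₂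
    obtain ⟨M', hM, hMT, hMV⟩ := ihM _ _ (s₁.unionC s) (.refl _)
    obtain ⟨N', hN, hNT, hNV⟩ := ihN _ _ (s₂.unionC s) hsub
    refine ⟨.letUnit M' N', by simp [erase, hM, hN],
      .letUnit (s.isBangC hΔ) k₁₂ k₁ k₂ hMT hNT, fun hV => ?_⟩
    cases hV with
    | core hV => cases hV
    | letUnit hV hW => exact .letUnit (hMV hV) (hNV hW)
  | @letPair Δ Γ₁ Γ₂ n x A y B M N C hΔ h₁₂ h₁ h₂ hxy hx hy _ _ ihM ihN =>
    have hx' := hctx.1 x hx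
    have hy' := hctx.1 y hy
    obtain ⟨Γ₁', Γ₂', Δ₀, rfl, k₁₂, k₁, k₂, s₁, s₂, s⟩ := hctx.exists_unionC h₁₂ h₁ h₂
    obtain ⟨M', hM, hMT, hMV⟩ := ihM _ _ (s₁.unionC s) (.refl _)
    obtain ⟨N', hN, hNT, hNV⟩ :=
      ihN _ _ (((s₂.unionC s).extC x (.refl _)).extC y (.refl _)) hsub
    refine ⟨.letPair n x A y B M' N', by simp [erase, hM, hN],
      .letPair (s.isBangC hΔ) k₁₂ k₁ k₂ hxy hx' hy' hMT hNT, fun hV => ?_⟩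
    cases hV with
    | core hV => cases hV
    | letPair _ _ _ _ _ hV hW => exact .letPair _ _ _ _ _ (hMV hV) (hNV hW)

end QLam
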